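/- In the near-separable setting with m = r, let A be any positive semidefinite matrix satisfying m̃_iᵀ A m̃_i ≤ 1 for every column m̃_i of M̃, and set C = Wᵀ A W and λ = λ_max(C). Then (1 − √r · ε/σ_min(W)) · √λ ≤ √r. -/

import Mathlib

open Matrix BigOperators

/-- Euclidean norm of a vector in `ℝ^m`. -/
noncomputable def colNorm {m : ℕ} (v : Fin m → ℝ) : ℝ := Real.sqrt (∑ i, (v i) ^ 2)

/-- Largest singular value of a matrix. -/
noncomputable def sigmaMax {m n : ℕ} (X : Matrix (Fin m) (Fin n) ℝ) : ℝ :=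
  sSup {c : ℝ | ∃ v : Fin n → ℝ, colNorm v = 1 ∧ c = colNorm (X.mulVec v)}

/-- Smallest singular value of a matrix. -/
noncomputable def sigmaMin {m n : ℕ} (X : Matrix (Fin m) (Fin n) ℝ) : ℝ :=
  sInf {c : ℝ | ∃ v : Fin n → ℝ, colNorm v = 1 ∧ c = colNorm (X.mulVec v)}

/-- Condition number `κ(X) = σ_max(X) / σ_min(X)`. -/
noncomputable def kappa {m n : ℕ} (X : Matrix (Fin m) (Fin n) ℝ) : ℝ :=
  sigmaMax X / sigmaMin X

/-- Largest eigenvalue of a symmetric matrix, via the Rayleigh quotient. -/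
noncomputable def lamMax {r : ℕ} (C : Matrix (Fin r) (Fin r) ℝ) : ℝ :=
  sSup {c : ℝ | ∃ v : Fin r → ℝ, colNorm v = 1 ∧ c = v ⬝ᵥ C.mulVec v}

/-- Smallest eigenvalue of a symmetric matrix, via the Rayleigh quotient. -/
noncomputable def lamMin {r : ℕ} (C : Matrix (Fin r) (Fin r) ℝ) : ℝ :=
  sInf {c : ℝ | ∃ v : Fin r → ℝ, colNorm v = 1 ∧ c = v ⬝ᵥ C.mulVec v}

/-- Near-separable assumption with `m = r`: `Mt = W * H + N` where `W ∈ ℝ^{r×r}` is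
invertible, `H = [I_r, H']` is nonnegative with column sums at most one and whose first `r`
columns form the identity matrix, and each column of `N` has Euclidean norm at most `ε`. -/
def NearSepSquare (r n : ℕ) (W : Matrix (Fin r) (Fin r) ℝ) (H : Matrix (Fin r) (Fin n) ℝ)
    (N Mt : Matrix (Fin r) (Fin n) ℝ) (ε : ℝ) : Prop :=
  IsUnit W.det ∧ Mt = W * H + N ∧ (∀ i j, 0 ≤ H i j) ∧ (∀ j, ∑ i, H i j ≤ 1) ∧
    (∃ h : r ≤ n, ∀ i j : Fin r, H i (Fin.castLE h j) = if i = j then 1 else 0) ∧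
    0 ≤ ε ∧ ∀ j, colNorm (fun i => N i j) ≤ ε

/-- `A` is feasible for the minimum-volume-ellipsoid SDP associated with `Mt`:
`A` is positive semidefinite and `m̃ᵢᵀ A m̃ᵢ ≤ 1` for every column `m̃ᵢ` of `Mt`. -/
def SDPFeasible {r n : ℕ} (Mt : Matrix (Fin r) (Fin n) ℝ)
    (A : Matrix (Fin r) (Fin r) ℝ) : Prop :=
  A.PosSemidef ∧ ∀ j : Fin n, (fun i => Mt i j) ⬝ᵥ A.mulVec (fun i => Mt i j) ≤ 1

/-- `A` is an optimal solution of the minimum-volume-ellipsoid SDP associated with `Mt`: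
it is feasible and maximizes the determinant among the feasible matrices. -/
def SDPOptimal {r n : ℕ} (Mt : Matrix (Fin r) (Fin n) ℝ)
    (A : Matrix (Fin r) (Fin r) ℝ) : Prop :=
  SDPFeasible Mt A ∧ ∀ B : Matrix (Fin r) (Fin r) ℝ, SDPFeasible Mt B → B.det ≤ A.det

open scoped MatrixOrder

theorem colNorm_eq_norm {m : ℕ} (v : Fin m → ℝ) : colNorm v = ‖WithLp.toLp 2 v‖ := by
  simp [colNorm, EuclideanSpace.norm_eq]

theorem colNorm_nonneg {m : ℕ} (v : Fin m → ℝ) : 0 ≤ colNorm v := Real.sqrt_nonneg _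

theorem colNorm_smul {m : ℕ} (c : ℝ) (v : Fin m → ℝ) : colNorm (c • v) = |c| * colNorm v := by
  rw [colNorm_eq_norm, colNorm_eq_norm, WithLp.toLp_smul, norm_smul, Real.norm_eq_abs]

theorem colNorm_sub_le {m : ℕ} (v w : Fin m → ℝ) : colNorm (v - w) ≤ colNorm v + colNorm w := by
  simp only [colNorm_eq_norm, WithLp.toLp_sub]
  exact norm_sub_le _ _

theorem colNorm_sum_le {m : ℕ} {ι : Type*} (s : Finset ι) (f : ι → Fin m → ℝ) :
    colNorm (∑ i ∈ s, f i) ≤ ∑ i ∈ s, colNorm (f i) := by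
  simp only [colNorm_eq_norm, WithLp.toLp_sum]
  exact norm_sum_le _ _

theorem colNorm_sq {m : ℕ} (v : Fin m → ℝ) : colNorm v ^ 2 = v ⬝ᵥ v := by
  rw [colNorm, Real.sq_sqrt (Finset.sum_nonneg fun i _ => sq_nonneg _)]
  simp [dotProduct, sq]

theorem colNorm_eq_zero {m : ℕ} {v : Fin m → ℝ} : colNorm v = 0 ↔ v = 0 := by
  simp [colNorm_eq_norm]

theorem exists_colNorm_eq_one_smul {m : ℕ} {u : Fin m → ℝ} (hu : u ≠ 0) :
    ∃ v, colNorm v = 1 ∧ u = colNorm u • v := by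
  have h : colNorm u ≠ 0 := colNorm_eq_zero.not.mpr hu
  refine ⟨(colNorm u)⁻¹ • u, ?_, ?_⟩
  · rw [colNorm_smul, abs_of_nonneg (inv_nonneg.mpr (colNorm_nonneg u)), inv_mul_cancel₀ h]
  · rw [smul_smul, mul_inv_cancel₀ h, one_smul]

theorem exists_colNorm_mulVec_le {m : ℕ} (X : Matrix (Fin m) (Fin m) ℝ) :
    ∃ K, 0 < K ∧ ∀ v, colNorm (X *ᵥ v) ≤ K * colNorm v := by
  obtain ⟨K, hK, h⟩ := (Matrix.toEuclideanCLM (𝕜 := ℝ) X).bound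
  refine ⟨K, hK, fun v => ?_⟩
  simpa [colNorm_eq_norm] using h (WithLp.toLp 2 v)

theorem sum_abs_le_sqrt_mul_colNorm {m : ℕ} (v : Fin m → ℝ) :
    ∑ i, |v i| ≤ Real.sqrt m * colNorm v := by
  rw [colNorm, ← Real.sqrt_mul (Nat.cast_nonneg m)]
  apply Real.le_sqrt_of_sq_le
  simpa using sq_sum_le_card_mul_sum_sq (s := Finset.univ) (f := fun i => |v i|)

theorem sigmaMin_mul_colNorm_le {m n : ℕ} (X : Matrix (Fin m) (Fin n) ℝ) (u : Fin n → ℝ) :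
    sigmaMin X * colNorm u ≤ colNorm (X *ᵥ u) := by
  rcases eq_or_ne u 0 with rfl | hu
  · simp [colNorm]
  obtain ⟨v, hv, huv⟩ := exists_colNorm_eq_one_smul hu
  have h : sigmaMin X ≤ colNorm (X *ᵥ v) :=
    csInf_le ⟨0, by rintro _ ⟨w, -, rfl⟩; exact colNorm_nonneg _⟩ ⟨v, hv, rfl⟩
  rw [show X *ᵥ u = colNorm u • X *ᵥ v by rw [← Matrix.mulVec_smul, ← huv], colNorm_smul,
    abs_of_nonneg (colNorm_nonneg u), mul_comm]
  exact mul_le_mul_of_nonneg_left h (colNorm_nonneg u)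

theorem exists_colNorm_eq_one {m : ℕ} (hm : 0 < m) : ∃ v : Fin m → ℝ, colNorm v = 1 := by
  refine ⟨Pi.single ⟨0, hm⟩ 1, ?_⟩
  simp [colNorm, Pi.single_apply]

theorem sigmaMin_pos {m : ℕ} (hm : 0 < m) {X : Matrix (Fin m) (Fin m) ℝ} (hX : IsUnit X.det) :
    0 < sigmaMin X := by
  obtain ⟨K, hK, h⟩ := exists_colNorm_mulVec_le X⁻¹
  obtain ⟨v, hv⟩ := exists_colNorm_eq_one hm
  refine (inv_pos.mpr hK).trans_le (le_csInf ⟨_, v, hv, rfl⟩ ?_)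
  rintro _ ⟨w, hw, rfl⟩
  have hXw := h (X *ᵥ w)
  rw [Matrix.mulVec_mulVec, Matrix.nonsing_inv_mul _ hX, Matrix.one_mulVec, hw] at hXw
  rwa [inv_le_iff_one_le_mul₀' hK]

theorem dotProduct_transpose_mul_self_mulVec {m n : ℕ} (X : Matrix (Fin m) (Fin n) ℝ)
    (v : Fin n → ℝ) : v ⬝ᵥ (Xᵀ * X) *ᵥ v = colNorm (X *ᵥ v) ^ 2 := by
  rw [colNorm_sq, ← Matrix.mulVec_mulVec, Matrix.dotProduct_mulVec, Matrix.vecMul_transpose]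

theorem colNorm_mulVec_le_sqrt_lamMax {m : ℕ} (X : Matrix (Fin m) (Fin m) ℝ) (u : Fin m → ℝ) :
    colNorm (X *ᵥ u) ≤ Real.sqrt (lamMax (Xᵀ * X)) * colNorm u := by
  rcases eq_or_ne u 0 with rfl | hu
  · simp [colNorm]
  obtain ⟨v, hv, huv⟩ := exists_colNorm_eq_one_smul hu
  obtain ⟨K, hK, hb⟩ := exists_colNorm_mulVec_le X
  have h : colNorm (X *ᵥ v) ≤ Real.sqrt (lamMax (Xᵀ * X)) := by
    apply Real.le_sqrt_of_sq_le
    refine le_csSup ⟨K ^ 2, ?_⟩ ⟨v, hv, (dotProduct_transpose_mul_self_mulVec X v).symm⟩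
    rintro _ ⟨w, hw, rfl⟩
    rw [dotProduct_transpose_mul_self_mulVec]
    have := hb w
    rw [hw, mul_one] at this
    exact pow_le_pow_left₀ (colNorm_nonneg _) this 2
  rw [show X *ᵥ u = colNorm u • X *ᵥ v by rw [← Matrix.mulVec_smul, ← huv], colNorm_smul,
    abs_of_nonneg (colNorm_nonneg u), mul_comm]
  exact mul_le_mul_of_nonneg_right h (colNorm_nonneg u)

theorem sqrt_lamMax_le {m : ℕ} (hm : 0 < m) {X : Matrix (Fin m) (Fin m) ℝ} {b : ℝ}
    (h : ∀ v, colNorm v = 1 → colNorm (X *ᵥ v) ≤ b) : Real.sqrt (lamMax (Xᵀ * X)) ≤ b := by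
  obtain ⟨v, hv⟩ := exists_colNorm_eq_one hm
  refine Real.sqrt_le_iff.mpr ⟨(colNorm_nonneg _).trans (h v hv), csSup_le ⟨_, v, hv, rfl⟩ ?_⟩
  rintro _ ⟨w, hw, rfl⟩
  rw [dotProduct_transpose_mul_self_mulVec]
  exact pow_le_pow_left₀ (colNorm_nonneg _) (h w hw) 2

/-- For any feasible solution `A` of the minimum-volume-ellipsoid SDP, with
`C = Wᵀ A W` and `λ = λ_max(C)`, one has `(1 − √r ε/σ_min(W)) √λ ≤ √r`. -/
theorem lamMax_sqrt_bound (r n : ℕ) (W : Matrix (Fin r) (Fin r) ℝ)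
    (H : Matrix (Fin r) (Fin n) ℝ) (N Mt : Matrix (Fin r) (Fin n) ℝ) (ε : ℝ)
    (A : Matrix (Fin r) (Fin r) ℝ)
    (hsep : NearSepSquare r n W H N Mt ε) (hA : SDPFeasible Mt A) :
    (1 - Real.sqrt r * ε / sigmaMin W) * Real.sqrt (lamMax (Wᵀ * A * W)) ≤ Real.sqrt r := by
  rcases Nat.eq_zero_or_pos r with rfl | hr
  · simp [lamMax, colNorm]
  obtain ⟨hW, hMt, -, -, ⟨hrn, hH⟩, -, hN⟩ := hsep
  obtain ⟨hpsd, hfeas⟩ := hA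
  obtain ⟨B, rfl⟩ : ∃ B : Matrix (Fin r) (Fin r) ℝ, A = Bᵀ * B := by
    obtain ⟨B, hB⟩ := CStarAlgebra.nonneg_iff_eq_star_mul_self.mp hpsd.nonneg
    exact ⟨B, by rw [hB, Matrix.star_eq_conjTranspose,
      Matrix.conjTranspose_eq_transpose_of_trivial]⟩
  have hC : Wᵀ * (Bᵀ * B) * W = (B * W)ᵀ * (B * W) := by
    simp only [Matrix.transpose_mul, Matrix.mul_assoc]
  rw [hC]
  have hσ := sigmaMin_pos hr hW
  set s := Real.sqrt (lamMax ((B * W)ᵀ * (B * W))) with hs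
  have hs0 : 0 ≤ s := Real.sqrt_nonneg _
  have hMt_le : ∀ j, colNorm (B *ᵥ fun i => Mt i j) ≤ 1 := fun j => by
    have h := hfeas j
    rw [dotProduct_transpose_mul_self_mulVec] at h
    exact (sq_le_one_iff₀ (colNorm_nonneg _)).mp h
  have hN_le : ∀ j, colNorm (B *ᵥ fun i => N i j) ≤ s * (ε / sigmaMin W) := fun j => by
    set u := W⁻¹ *ᵥ fun i => N i j with hu
    have hWu : W *ᵥ u = fun i => N i j := by
      rw [hu, Matrix.mulVec_mulVec, Matrix.mul_nonsing_inv _ hW, Matrix.one_mulVec]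
    rw [← hWu, Matrix.mulVec_mulVec]
    refine (colNorm_mulVec_le_sqrt_lamMax _ u).trans (mul_le_mul_of_nonneg_left ?_ hs0)
    rw [le_div_iff₀' hσ]
    exact (sigmaMin_mul_colNorm_le W u).trans (hWu ▸ hN j)
  have hcol : ∀ j : Fin r, (fun i => W i j) =
      (fun i => Mt i (Fin.castLE hrn j)) - fun i => N i (Fin.castLE hrn j) := fun j => by
    ext i
    simp [hMt, Matrix.mul_apply, hH]
  have hW_le : ∀ j : Fin r, colNorm (B *ᵥ fun i => W i j) ≤ 1 + s * (ε / sigmaMin W) :=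
    fun j => by
      rw [hcol, Matrix.mulVec_sub]
      exact (colNorm_sub_le _ _).trans (add_le_add (hMt_le _) (hN_le _))
  have hb0 : 0 ≤ 1 + s * (ε / sigmaMin W) := (colNorm_nonneg _).trans (hW_le ⟨0, hr⟩)
  have key : s ≤ Real.sqrt r * (1 + s * (ε / sigmaMin W)) := by
    refine sqrt_lamMax_le hr fun v hv => ?_
    have hsum : (B * W) *ᵥ v = ∑ j, v j • B *ᵥ fun i => W i j := by
      rw [← Matrix.mulVec_mulVec]
      simp_rw [← Matrix.mulVec_smul]
      rw [← Matrix.mulVec_sum]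
      congr 1
      ext i
      simp [Matrix.mulVec, dotProduct, mul_comm]
    calc colNorm ((B * W) *ᵥ v)
        ≤ ∑ j, colNorm (v j • B *ᵥ fun i => W i j) := hsum ▸ colNorm_sum_le _ _
      _ ≤ ∑ j, |v j| * (1 + s * (ε / sigmaMin W)) := Finset.sum_le_sum fun j _ => by
          rw [colNorm_smul]
          exact mul_le_mul_of_nonneg_left (hW_le j) (abs_nonneg _)
      _ ≤ Real.sqrt r * (1 + s * (ε / sigmaMin W)) := by
          rw [← Finset.sum_mul]
          refine mul_le_mul_of_nonneg_right ?_ hb0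
          simpa [hv] using sum_abs_le_sqrt_mul_colNorm v
  calc (1 - Real.sqrt r * ε / sigmaMin W) * s
      = s - Real.sqrt r * (s * (ε / sigmaMin W)) := by ring
    _ ≤ Real.sqrt r := by linarith
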